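/- arXiv:2210.02846 — 2 statements merged into one kernel-verified Lean document; each statement's English description precedes it below -/
import Mathlib

section
/- Suppose β_h → +∞, μ is a nonnegative Radon measure on Z × Z whose thermalizations μ_{β_h} are finite measures converging narrowly to a finite nonnegative measure μ_∞. Then μ_∞ is supported on the diagonal: μ_∞((Z × Z) \ {(z, z) : z ∈ Z}) = 0. -/
open MeasureTheory Real Filter Topology

noncomputable section

/-- Phase space `Z`, identified with `ℝ^{2N}` (with Lebesgue measure `volume`). -/
abbrev ZZ (N : ℕ) := EuclideanSpace ℝ (Fin (2 * N))

/-- The normalization constant `B_β = ∫_Z exp(−β‖ξ‖²) dL^{2N}(ξ)`. -/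
def Bconst (N : ℕ) (β : ℝ) : ℝ := ∫ ξ : ZZ N, Real.exp (-β * ‖ξ‖ ^ 2)

/-- The thermalization `μ_β := w_β · μ` with `w_β(y,z) = B_β⁻¹ exp(−β‖y−z‖²)`. -/
def therm {N : ℕ} (μ : Measure (ZZ N × ZZ N)) (β : ℝ) : Measure (ZZ N × ZZ N) :=
  μ.withDensity fun q => ENNReal.ofReal ((Bconst N β)⁻¹ * Real.exp (-β * ‖q.1 - q.2‖ ^ 2))

/-- The deterministic physical likelihood `μ_E = H^N ⌞ E`. -/
def muE (N : ℕ) (E : AffineSubspace ℝ (ZZ N)) : Measure (ZZ N) :=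
  (μH[(N : ℝ)]).restrict (E : Set (ZZ N))

/-- The sub-Gaussian material likelihood `μ_D = e^{−Φ} L^{2N}`. -/
def muD (N : ℕ) (Φ : ZZ N → ℝ) : Measure (ZZ N) :=
  volume.withDensity fun y => ENNReal.ofReal (Real.exp (-Φ y))

/-!
STATEMENT 5: If `β_h → +∞` and the thermalizations `μ_{β_h}` of a nonnegative measure
`μ` on `Z × Z` are finite measures converging narrowly to a finite measure `μ_∞`,
then `μ_∞` is supported on the diagonal: `μ_∞((Z×Z) \ diag) = 0`.
-/

lemma Bconst_eq (N : ℕ) {β : ℝ} (hβ : 0 < β) : Bconst N β = (π / β) ^ N := by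
  have hdim : ((Module.finrank ℝ (ZZ N) : ℕ) : ℝ) / 2 = (N : ℝ) := by simp
  rw [Bconst, GaussianFourier.integral_rexp_neg_mul_sq_norm hβ, hdim, Real.rpow_natCast]

/-- Comparison of two thermal weights at distance at least `δ` from the diagonal. -/
lemma thermal_weight_le (N : ℕ) {β₀ β δ r : ℝ} (hβ₀ : 0 < β₀) (hβ : β₀ ≤ β) (hδ : 0 ≤ δ)
    (hr : δ ≤ r) :
    (Bconst N β)⁻¹ * Real.exp (-β * r ^ 2) ≤
      (β ^ N * Real.exp (-δ ^ 2 * β) * ((β₀ ^ N)⁻¹ * Real.exp (β₀ * δ ^ 2))) *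
        ((Bconst N β₀)⁻¹ * Real.exp (-β₀ * r ^ 2)) := by
  have hβpos : 0 < β := hβ₀.trans_le hβ
  have hexp : Real.exp (-β * r ^ 2) ≤
      Real.exp (-δ ^ 2 * β) * Real.exp (β₀ * δ ^ 2) * Real.exp (-β₀ * r ^ 2) := by
    rw [← Real.exp_add, ← Real.exp_add, Real.exp_le_exp]
    have hsq : δ ^ 2 ≤ r ^ 2 := by gcongr
    nlinarith [mul_nonneg (sub_nonneg.2 hβ) (sub_nonneg.2 hsq)]
  rw [Bconst_eq N hβpos, Bconst_eq N hβ₀]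
  calc ((π / β) ^ N)⁻¹ * Real.exp (-β * r ^ 2)
      ≤ ((π / β) ^ N)⁻¹ *
        (Real.exp (-δ ^ 2 * β) * Real.exp (β₀ * δ ^ 2) * Real.exp (-β₀ * r ^ 2)) := by
        gcongr
    _ = _ := by
        have hπ := Real.pi_pos
        rw [div_pow, div_pow]
        field_simp

/-- Thermalized mass at distance at least `δ` from the diagonal is controlled by the mass at a
lower inverse temperature. -/
lemma therm_far_le {N : ℕ} (μ : Measure (ZZ N × ZZ N)) {β₀ β δ : ℝ} (hβ₀ : 0 < β₀)
    (hβ : β₀ ≤ β) (hδ : 0 ≤ δ) :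
    therm μ β {q | δ ≤ ‖q.1 - q.2‖} ≤
      ENNReal.ofReal (β ^ N * Real.exp (-δ ^ 2 * β) * ((β₀ ^ N)⁻¹ * Real.exp (β₀ * δ ^ 2))) *
        therm μ β₀ {q | δ ≤ ‖q.1 - q.2‖} := by
  have hS : MeasurableSet {q : ZZ N × ZZ N | δ ≤ ‖q.1 - q.2‖} :=
    measurableSet_le (by fun_prop) (by fun_prop)
  have hβpos : 0 < β := hβ₀.trans_le hβ
  rw [therm, therm, withDensity_apply _ hS, withDensity_apply _ hS,
    ← lintegral_const_mul' _ _ ENNReal.ofReal_ne_top]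
  refine setLIntegral_mono' hS fun q hq => ?_
  rw [← ENNReal.ofReal_mul (by positivity)]
  exact ENNReal.ofReal_le_ofReal (thermal_weight_le N hβ₀ hβ hδ hq)

lemma tendsto_therm_far {N : ℕ} (μ : Measure (ZZ N × ZZ N)) {βs : ℕ → ℝ}
    (hβs : Tendsto βs atTop atTop) (hfin : ∀ h, IsFiniteMeasure (therm μ (βs h))) {δ : ℝ}
    (hδ : 0 < δ) :
    Tendsto (fun h => (therm μ (βs h)).real {q | δ ≤ ‖q.1 - q.2‖}) atTop (𝓝 0) := by
  obtain ⟨h₀, hh₀⟩ := (hβs.eventually_gt_atTop 0).exists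
  have hdecay : Tendsto (fun h => βs h ^ N * Real.exp (-δ ^ 2 * βs h)) atTop (𝓝 0) := by
    have := (tendsto_rpow_mul_exp_neg_mul_atTop_nhds_zero N (δ ^ 2) (by positivity)).comp hβs
    simpa [Function.comp_def] using this
  have hbound := (hdecay.mul_const
    ((βs h₀ ^ N)⁻¹ * Real.exp (βs h₀ * δ ^ 2))).mul_const
      ((therm μ (βs h₀)).real {q | δ ≤ ‖q.1 - q.2‖})
  rw [zero_mul, zero_mul] at hbound
  refine squeeze_zero' (.of_forall fun h => measureReal_nonneg) ?_ hbound
  filter_upwards [hβs.eventually_ge_atTop (βs h₀)] with h hh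
  have hβpos : 0 < βs h := hh₀.trans_le hh
  have hle := ENNReal.toReal_mono
    (ENNReal.mul_ne_top ENNReal.ofReal_ne_top (measure_ne_top _ _))
    (therm_far_le μ hh₀ hh hδ.le)
  rwa [ENNReal.toReal_mul, ENNReal.toReal_ofReal (by positivity)] at hle

/-- A bounded continuous function that is positive exactly where `‖q.1 - q.2‖ > δ`. -/
def offDiagonalCutoff (N : ℕ) (δ : ℝ) : BoundedContinuousFunction (ZZ N × ZZ N) ℝ :=
  BoundedContinuousFunction.ofNormedAddCommGroup
    (fun q => min 1 (max 0 (‖q.1 - q.2‖ - δ))) (by fun_prop) 1 fun q => by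
      rw [Real.norm_of_nonneg (le_min zero_le_one (le_max_left _ _))]
      exact min_le_left _ _

lemma offDiagonalCutoff_apply (N : ℕ) (δ : ℝ) (q : ZZ N × ZZ N) :
    offDiagonalCutoff N δ q = min 1 (max 0 (‖q.1 - q.2‖ - δ)) := rfl

lemma offDiagonalCutoff_nonneg (N : ℕ) (δ : ℝ) (q : ZZ N × ZZ N) :
    0 ≤ offDiagonalCutoff N δ q :=
  le_min zero_le_one (le_max_left _ _)

lemma integral_offDiagonalCutoff_le {N : ℕ} (δ : ℝ) (ν : Measure (ZZ N × ZZ N))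
    [IsFiniteMeasure ν] :
    ∫ q, offDiagonalCutoff N δ q ∂ν ≤ ν.real {q | δ ≤ ‖q.1 - q.2‖} := by
  have hS : MeasurableSet {q : ZZ N × ZZ N | δ ≤ ‖q.1 - q.2‖} :=
    measurableSet_le (by fun_prop) (by fun_prop)
  rw [← integral_indicator_one hS]
  refine integral_mono ((offDiagonalCutoff N δ).integrable ν)
    ((integrable_const (1 : ℝ)).indicator hS) fun q => ?_
  rw [offDiagonalCutoff_apply, Set.indicator_apply]
  split_ifs with hq
  · exact min_le_left _ _
  · have hlt : ‖q.1 - q.2‖ < δ := not_le.1 fun hle => hq hle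
    rw [max_eq_left (by linarith)]
    exact min_le_right _ _

theorem diagonal_concentration_supported_on_diagonal
    (N : ℕ) (μ : Measure (ZZ N × ZZ N))
    (βs : ℕ → ℝ) (hβs : Tendsto βs atTop atTop)
    (μlim : Measure (ZZ N × ZZ N)) [IsFiniteMeasure μlim]
    (hfin : ∀ h : ℕ, IsFiniteMeasure (therm μ (βs h)))
    (hconv : ∀ f : BoundedContinuousFunction (ZZ N × ZZ N) ℝ,
      Tendsto (fun h : ℕ => ∫ q, f q ∂(therm μ (βs h))) atTop (𝓝 (∫ q, f q ∂μlim))) :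
    μlim {q : ZZ N × ZZ N | q.1 = q.2}ᶜ = 0 := by
  have hae : ∀ n : ℕ, ∀ᵐ q ∂μlim, ‖q.1 - q.2‖ ≤ 1 / ((n : ℝ) + 1) := by
    intro n
    have hδ : 0 < 1 / ((n : ℝ) + 1) := by positivity
    have hzero : ∫ q, offDiagonalCutoff N (1 / ((n : ℝ) + 1)) q ∂μlim = 0 :=
      tendsto_nhds_unique (hconv _) <| squeeze_zero
        (fun h => integral_nonneg (offDiagonalCutoff_nonneg N _))
        (fun h => integral_offDiagonalCutoff_le _ _) (tendsto_therm_far μ hβs hfin hδ)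
    rw [integral_eq_zero_iff_of_nonneg (offDiagonalCutoff_nonneg N _)
      (BoundedContinuousFunction.integrable _ _)] at hzero
    filter_upwards [hzero] with q hq
    by_contra! hlt
    have hpos : 0 < offDiagonalCutoff N (1 / ((n : ℝ) + 1)) q :=
      lt_min one_pos (lt_max_of_lt_right (sub_pos.2 hlt))
    exact hpos.ne' hq
  have hdiag : ∀ᵐ q ∂μlim, q.1 = q.2 := by
    filter_upwards [ae_all_iff.2 hae] with q hq
    have hnorm : ‖q.1 - q.2‖ ≤ 0 := ge_of_tendsto' tendsto_one_div_add_atTop_nhds_zero_nat hq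
    exact sub_eq_zero.1 (norm_le_zero_iff.1 hnorm)
  exact hdiag
end
end

section
/- Let μ = μ_D × H^N⌞E with μ_D a nonnegative Radon measure on Z and E an N-dimensional affine subspace. Assume: (1) the thermalizations μ_β for β ≥ β₀ > 0 are uniformly bounded and uniformly tight. Let β_h → +∞ and ε_h → 0, and for each h let P_h ⊂ Z be a countable set with a Borel partition {A_p : p ∈ P_h} of Z satisfying p ∈ A_p and μ_D(A_p) < ∞, and weights m_p ≥ 0 defining μ_{D,h} := Σ_{p∈P_h} m_p δ_p and μ_h := μ_{D,h} × H^N⌞E. Assume further: (2) m_p ≤ c̄ μ_D(A_p) for a constant c̄ > 0 uniform in h and p; (3) the sequence (β_h ε_h²) is bounded; (4) there is c_* ≥ 1 such that ‖p − z‖² ≤ c_*²(ε_h² + ‖y − z‖²) for every h, p ∈ P_h, z ∈ E and y ∈ A_p; (5) ∫_{A_p} ‖y − p‖² dμ_D(y) ≤ ε_h² μ_D(A_p) for all h and p ∈ P_h. Then there is h₀ such that the sequence of thermalized measures ((μ_h)_{β_h})_{h ≥ h₀} is uniformly bounded: sup_{h ≥ h₀} (μ_h)_{β_h}(Z × Z)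 < ∞. -/
open MeasureTheory Real Filter Topology

noncomputable section

/-- The Hausdorff measure restricted to an `N`-dimensional affine subspace is s-finite. -/
theorem sFinite_muE (N : ℕ) (E : AffineSubspace ℝ (ZZ N)) (hE : (E : Set (ZZ N)).Nonempty)
    (hdim : Module.finrank ℝ E.direction = N) : SFinite (muE N E) := by
  obtain ⟨x, hx⟩ := hE
  have hf : Isometry (fun v : E.direction => (v : ZZ N) + x) :=
    (IsometryEquiv.addRight x).isometry.comp isometry_subtype_coe
  have hrange : Set.range (fun v : E.direction => (v : ZZ N) + x) = (E : Set (ZZ N)) := by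
    ext z
    constructor
    · rintro ⟨v, rfl⟩
      exact AffineSubspace.vadd_mem_of_mem_direction v.2 hx
    · intro hz
      exact ⟨⟨z - x, AffineSubspace.vsub_mem_direction hz hx⟩, by simp⟩
  have hmap := hf.map_hausdorffMeasure (d := (N : ℝ)) (Or.inl (by positivity))
  rw [hrange] at hmap
  have hhaar : (μH[(N : ℝ)] : Measure E.direction).IsAddHaarMeasure := by
    have hcast : (N : ℝ) = (Module.finrank ℝ E.direction : ℝ) := congrArg _ hdim.symm
    simp only [hcast]
    infer_instance
  rw [muE, ← hmap]
  infer_instance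

theorem Bconst_inv_eq (N : ℕ) {β : ℝ} (hβ : 0 < β) :
    (Bconst N β)⁻¹ = 2 ^ N * (Bconst N (β / 2))⁻¹ := by
  have key : ∀ b : ℝ, 0 < b → Bconst N b = (π / b) ^ N := by
    intro b hb
    have hfinrank : ((Module.finrank ℝ (ZZ N) : ℕ) : ℝ) / 2 = N := by
      simp
    rw [Bconst, GaussianFourier.integral_rexp_neg_mul_sq_norm hb, hfinrank, Real.rpow_natCast]
  rw [key β hβ, key (β / 2) (by positivity), ← inv_pow, ← inv_pow, ← mul_pow]
  congr 1
  field_simp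

/-- Moving the first argument of the thermal weight by at most `√2 ε` costs a bounded factor,
provided the inverse temperature is halved. -/
theorem thermal_weight_le_s12 (N : ℕ) {β ε Cb : ℝ} (hβ : 0 < β) (hβε : β * ε ^ 2 ≤ Cb)
    {x y : ZZ N} (hxy : ‖y - x‖ ^ 2 ≤ 2 * ε ^ 2) (z : ZZ N) :
    (Bconst N β)⁻¹ * Real.exp (-β * ‖x - z‖ ^ 2) ≤
      (2 ^ N * Real.exp (2 * Cb)) *
        ((Bconst N (β / 2))⁻¹ * Real.exp (-(β / 2) * ‖y - z‖ ^ 2)) := by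
  have hB : 0 ≤ Bconst N (β / 2) := integral_nonneg fun _ => (Real.exp_pos _).le
  have htri : ‖y - z‖ ≤ ‖y - x‖ + ‖x - z‖ := norm_sub_le_norm_sub_add_norm_sub y x z
  have hsq : ‖y - z‖ ^ 2 ≤ 4 * ε ^ 2 + 2 * ‖x - z‖ ^ 2 := by
    nlinarith [norm_nonneg (y - z), norm_nonneg (y - x), norm_nonneg (x - z),
      sq_nonneg (‖y - x‖ - ‖x - z‖)]
  have hexp : Real.exp (-β * ‖x - z‖ ^ 2) ≤
      Real.exp (2 * Cb) * Real.exp (-(β / 2) * ‖y - z‖ ^ 2) := by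
    rw [← Real.exp_add, Real.exp_le_exp]
    nlinarith [mul_le_mul_of_nonneg_left hsq hβ.le]
  calc (Bconst N β)⁻¹ * Real.exp (-β * ‖x - z‖ ^ 2)
      ≤ (2 ^ N * (Bconst N (β / 2))⁻¹) *
          (Real.exp (2 * Cb) * Real.exp (-(β / 2) * ‖y - z‖ ^ 2)) := by
        rw [Bconst_inv_eq N hβ]
        gcongr
    _ = _ := by ring

/-- If the second moment of `μ` on `A` about `x` is at most `ε² μ(A)`, then at least half of the
mass of `A` lies within distance `√2 ε` of `x`, so lower bounds there control `μ(A)`. -/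
theorem measure_mul_le_of_second_moment {X : Type*} [NormedAddCommGroup X]
    [MeasurableSpace X] [BorelSpace X] {μ : Measure X} {A : Set X}
    (hAfin : μ A < ⊤) {x : X} {ε : ℝ} (hε : 0 < ε)
    (hmom : ∫⁻ y in A, ENNReal.ofReal (‖y - x‖ ^ 2) ∂μ ≤ ENNReal.ofReal (ε ^ 2) * μ A)
    {a : ENNReal} {g : X → ENNReal} (hg : ∀ y, ‖y - x‖ ^ 2 ≤ 2 * ε ^ 2 → a ≤ g y) :
    μ A * a ≤ 2 * ∫⁻ y in A, g y ∂μ := by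
  have hmeas : Measurable fun y : X => ‖y - x‖ ^ 2 := by
    fun_prop
  set G : Set X := {y | ‖y - x‖ ^ 2 ≤ 2 * ε ^ 2} with hG
  have hGmeas : MeasurableSet G := hmeas measurableSet_Iic
  set ν := μ.restrict A with hν
  have hfin : ν Set.univ ≠ ⊤ := by simpa [hν] using hAfin.ne
  have hmarkov : 2 * ν Gᶜ ≤ ν Set.univ := by
    have h1 : ENNReal.ofReal (2 * ε ^ 2) * ν Gᶜ ≤ ENNReal.ofReal (ε ^ 2) * ν Set.univ := by
      calc ENNReal.ofReal (2 * ε ^ 2) * ν Gᶜ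
          ≤ ENNReal.ofReal (2 * ε ^ 2) *
              ν {y | ENNReal.ofReal (2 * ε ^ 2) ≤ ENNReal.ofReal (‖y - x‖ ^ 2)} := by
            gcongr
            intro y hy
            exact ENNReal.ofReal_le_ofReal
              (not_le.mp (show ¬ ‖y - x‖ ^ 2 ≤ 2 * ε ^ 2 from hy)).le
        _ ≤ ∫⁻ y, ENNReal.ofReal (‖y - x‖ ^ 2) ∂ν :=
            mul_meas_ge_le_lintegral hmeas.ennreal_ofReal _
        _ ≤ _ := by simpa [hν] using hmom
    have h2 : ENNReal.ofReal (2 * ε ^ 2) = ENNReal.ofReal (ε ^ 2) * 2 := by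
      rw [mul_comm, ENNReal.ofReal_mul (by positivity)]
      simp
    rw [h2, mul_assoc] at h1
    exact (ENNReal.mul_le_mul_iff_right (by simpa using hε.ne') ENNReal.ofReal_ne_top).mp h1
  have hhalf : ν Set.univ ≤ 2 * ν G := by
    have hadd : ν G + ν Gᶜ = ν Set.univ := measure_add_measure_compl hGmeas
    have hcompl : ν Gᶜ ≠ ⊤ := ne_top_of_le_ne_top hfin (measure_mono (Set.subset_univ _))
    have hle : ν Gᶜ ≤ ν G := by
      rw [← hadd, two_mul] at hmarkov
      exact (ENNReal.add_le_add_iff_right hcompl).mp hmarkov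
    rw [← hadd, two_mul]
    gcongr
  calc μ A * a = ν Set.univ * a := by simp [hν]
    _ ≤ 2 * ν G * a := by gcongr
    _ = 2 * ∫⁻ _ in G, a ∂ν := by rw [setLIntegral_const, mul_assoc, mul_comm a]
    _ ≤ 2 * ∫⁻ y in G, g y ∂ν := by
        gcongr 2 * ?_
        exact setLIntegral_mono' hGmeas fun y hy => hg y hy
    _ ≤ 2 * ∫⁻ y, g y ∂ν := by
        gcongr 2 * ?_
        exact setLIntegral_le_lintegral _ _

theorem measurable_thermal_weight (N : ℕ) (β : ℝ) : Measurable fun q : ZZ N × ZZ N =>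
    ENNReal.ofReal ((Bconst N β)⁻¹ * Real.exp (-β * ‖q.1 - q.2‖ ^ 2)) := by
  fun_prop

theorem therm_prod_univ {N : ℕ} (μ ν : Measure (ZZ N)) [SFinite ν] (β : ℝ) :
    therm (μ.prod ν) β Set.univ = ∫⁻ y, ∫⁻ z,
      ENNReal.ofReal ((Bconst N β)⁻¹ * Real.exp (-β * ‖y - z‖ ^ 2)) ∂ν ∂μ := by
  rw [therm, withDensity_apply _ MeasurableSet.univ, Measure.restrict_univ,
    lintegral_prod _ (measurable_thermal_weight N β).aemeasurable]

/-!
STATEMENT 12: uniform boundedness of thermalized discrete approximations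
(Prop. "Boundedness and tightness", part a). Under hypotheses (1)–(5),
there is `h₀` such that `sup_{h ≥ h₀} (μ_h)_{β_h}(Z × Z) < ∞`.
-/

theorem discrete_approximation_uniformly_bounded
    (N : ℕ) (μD : Measure (ZZ N))
    (E : AffineSubspace ℝ (ZZ N)) (hE : (E : Set (ZZ N)).Nonempty)
    (hdim : Module.finrank ℝ E.direction = N)
    (β₀ : ℝ) (hβ₀ : 0 < β₀)
    -- (1) uniform boundedness and tightness of the thermalizations of μ = μ_D × μ_E
    (hbd : ∃ C : ENNReal, C < ⊤ ∧ ∀ β : ℝ, β₀ ≤ β →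
      (therm (μD.prod (muE N E)) β) Set.univ ≤ C)
    (htight : ∀ δ : ℝ, 0 < δ → ∃ K : Set (ZZ N × ZZ N), IsCompact K ∧
      ∀ β : ℝ, β₀ ≤ β → (therm (μD.prod (muE N E)) β) Kᶜ < ENNReal.ofReal δ)
    -- annealing and resolution sequences
    (β : ℕ → ℝ) (hβ : Tendsto β atTop atTop)
    (ε : ℕ → ℝ) (hεpos : ∀ h, 0 < ε h) (hε : Tendsto ε atTop (𝓝 0))
    -- for every h, a countable Borel partition {A_p : p ∈ P_h} of Z with p ∈ A_p
    (ι : ℕ → Type) [∀ h, Countable (ι h)]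
    (p : ∀ h, ι h → ZZ N) (A : ∀ h, ι h → Set (ZZ N))
    (hAmeas : ∀ h i, MeasurableSet (A h i))
    (hdisj : ∀ h, Pairwise fun i j => Disjoint (A h i) (A h j))
    (hcover : ∀ h, (⋃ i, A h i) = Set.univ)
    (hpA : ∀ h i, p h i ∈ A h i)
    (hAfin : ∀ h i, μD (A h i) < ⊤)
    -- weights
    (m : ∀ h, ι h → ENNReal)
    -- (2) m_p ≤ c̄ μ_D(A_p)
    (cbar : ℝ) (hcbar : 0 < cbar)
    (hm : ∀ h i, m h i ≤ ENNReal.ofReal cbar * μD (A h i))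
    -- (3) (β_h ε_h²) is bounded
    (hβε : ∃ Cb : ℝ, ∀ h, |β h * (ε h) ^ 2| ≤ Cb)
    -- (4) ‖p − z‖² ≤ c_*²(ε_h² + ‖y − z‖²)
    (cstar : ℝ) (hcstar : 1 ≤ cstar)
    (hcell : ∀ h, ∀ i, ∀ z ∈ E, ∀ y ∈ A h i,
      ‖p h i - z‖ ^ 2 ≤ cstar ^ 2 * ((ε h) ^ 2 + ‖y - z‖ ^ 2))
    -- (5) second moments
    (hmom : ∀ h i, ∫⁻ y in A h i, ENNReal.ofReal (‖y - p h i‖ ^ 2) ∂μD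
      ≤ ENNReal.ofReal ((ε h) ^ 2) * μD (A h i)) :
    ∃ h₀ : ℕ, ∃ C : ENNReal, C < ⊤ ∧ ∀ h, h₀ ≤ h →
      (therm ((Measure.sum fun i => m h i • Measure.dirac (p h i)).prod (muE N E)) (β h))
        Set.univ ≤ C := by
  have := sFinite_muE N E hE hdim
  obtain ⟨C, hC, hCbd⟩ := hbd
  obtain ⟨Cb, hCb⟩ := hβε
  obtain ⟨h₀, hh₀⟩ := eventually_atTop.mp (hβ.eventually_ge_atTop (2 * β₀))
  set K : ENNReal := ENNReal.ofReal (2 ^ N * Real.exp (2 * Cb)) with hK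
  refine ⟨h₀, ENNReal.ofReal cbar * (2 * (K * C)), by finiteness, fun h hh => ?_⟩
  have hβh : 2 * β₀ ≤ β h := hh₀ h hh
  have hβpos : 0 < β h := by linarith
  set F : ℝ → ZZ N → ENNReal := fun b y => ∫⁻ z,
    ENNReal.ofReal ((Bconst N b)⁻¹ * Real.exp (-b * ‖y - z‖ ^ 2)) ∂(muE N E) with hF
  have hcmp : ∀ i y, ‖y - p h i‖ ^ 2 ≤ 2 * ε h ^ 2 →
      F (β h) (p h i) ≤ K * F (β h / 2) y := by
    intro i y hy
    rw [hF, hK]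
    dsimp only
    rw [← lintegral_const_mul' _ _ ENNReal.ofReal_ne_top]
    refine lintegral_mono fun z => ?_
    rw [← ENNReal.ofReal_mul (by positivity)]
    exact ENNReal.ofReal_le_ofReal
      (thermal_weight_le_s12 N hβpos ((le_abs_self _).trans (hCb h)) hy z)
  have hcell_le : ∀ i, m h i * F (β h) (p h i) ≤
      ENNReal.ofReal cbar * (2 * (K * ∫⁻ y in A h i, F (β h / 2) y ∂μD)) := by
    intro i
    have hmass := measure_mul_le_of_second_moment (hAfin h i) (hεpos h) (hmom h i) (hcmp i)
    rw [lintegral_const_mul' _ _ ENNReal.ofReal_ne_top] at hmass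
    calc m h i * F (β h) (p h i)
        ≤ ENNReal.ofReal cbar * μD (A h i) * F (β h) (p h i) := by
          gcongr
          exact hm h i
      _ ≤ _ := by
          rw [mul_assoc]
          gcongr
  rw [therm_prod_univ, lintegral_sum_measure]
  simp only [lintegral_smul_measure, lintegral_dirac, smul_eq_mul]
  calc ∑' i, m h i * F (β h) (p h i)
      ≤ ∑' i, ENNReal.ofReal cbar * (2 * (K * ∫⁻ y in A h i, F (β h / 2) y ∂μD)) :=
        ENNReal.tsum_le_tsum hcell_le
    _ = ENNReal.ofReal cbar * (2 * (K * ∫⁻ y, F (β h / 2) y ∂μD)) := by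
        rw [ENNReal.tsum_mul_left, ENNReal.tsum_mul_left, ENNReal.tsum_mul_left,
          ← lintegral_iUnion (hAmeas h) (hdisj h), hcover h, Measure.restrict_univ]
    _ ≤ ENNReal.ofReal cbar * (2 * (K * C)) := by
        gcongr
        rw [hF, ← therm_prod_univ]
        exact hCbd _ (by linarith)
end
end
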